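/- arXiv:2011.14269 — 2 statements merged into one kernel-verified Lean document; each statement's English description precedes it below -/
import Mathlib

section
/- Let σ : ℝ → ℝ be Lipschitz with σ(0) = 0 and Lipschitz constant Lip(σ), and let P be a probability measure on ℝ^d supported in the closed ball of radius R centered at 0. Let ρ be a probability measure on ℝ × ℝ^d × ℝ (parameters (a, w, b)) with path norm M defined by M² = ∫ a² (‖w‖² + b²) dρ(a,w,b) < ∞, and let V(x) = ∫ a σ(w·x + b) dρ(a,w,b), Q = Q_V. Then for every m ∈ ℕ there exist parameters (a_1,w_1,b_1), …, (a_m,w_m,b_m) such that, setting V_m(x) = (1/m) Σ_{j=1}^m a_j σ(w_j·x + b_j) and Q_m = Q_{V_m}, one has KL(Q ‖ Q_m) ≤ 2√3 · Lip(σ) · √(R²+1) · M / √m and (1/m) Σ_{j=1}^m a_j² (‖w_j‖² + b_j²) ≤ 2 M². -/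
open MeasureTheory Real
open scoped RealInnerProductSpace BigOperators

/-- The Gibbs (bias potential) distribution generated by potential `V` with base
distribution `P`: the measure with density `e^{-V} / ∫ e^{-V} dP` with respect to `P`. -/
noncomputable def gibbs {X : Type*} [MeasurableSpace X] (P : Measure X) (V : X → ℝ) :
    Measure X :=
  P.withDensity fun x => ENNReal.ofReal (Real.exp (-V x) / ∫ y, Real.exp (-V y) ∂P)

/-- The Kullback–Leibler divergence `KL(Q₁‖Q₂) = ∫ log (dQ₁/dQ₂) dQ₁`. -/
noncomputable def klDiv {X : Type*} [MeasurableSpace X] (Q1 Q2 : Measure X) : ℝ :=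
  ∫ x, Real.log ((Q1.rnDeriv Q2) x).toReal ∂Q1

noncomputable def Hrec {Ω E : Type*} [MeasurableSpace Ω] [AddCommGroup E]
    (ν : Measure Ω) (G : Ω → E) (F : E → ℝ) : ℕ → E → ℝ
  | 0 => F
  | k + 1 => fun c => ∫ ω, Hrec ν G F k (c + G ω) ∂ν

set_option linter.unusedSectionVars false

section abstract_part
variable {Ω E : Type*} [MeasurableSpace Ω] [NormedAddCommGroup E] [NormedSpace ℝ E]

lemma integrable_lip_comp (ν : Measure Ω) [IsProbabilityMeasure ν] {F : E → ℝ} {C : NNReal}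
    (hF : LipschitzWith C F) {G : Ω → E} (hG : Integrable G ν) (c : E) :
    Integrable (fun ω => F (c + G ω)) ν := by
  have h1 : Integrable (fun ω => ‖F c‖ + C * ‖G ω‖) ν :=
    (integrable_const _).add (hG.norm.const_mul _)
  refine h1.mono' ?_ ?_
  · exact hF.continuous.comp_aestronglyMeasurable (aestronglyMeasurable_const.add hG.1)
  · refine Filter.Eventually.of_forall fun ω => ?_
    have h2 := hF.norm_sub_le (c + G ω) c
    have h3 : ‖F (c + G ω)‖ ≤ ‖F c‖ + ‖F (c + G ω) - F c‖ := by
      have := norm_add_le (F c) (F (c + G ω) - F c)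
      simpa using this
    simp only [add_sub_cancel_left] at h2
    linarith

lemma Hrec_lip (ν : Measure Ω) [IsProbabilityMeasure ν] {F : E → ℝ} {C : NNReal}
    (hF : LipschitzWith C F) {G : Ω → E} (hG : Integrable G ν) (k : ℕ) :
    LipschitzWith C (Hrec ν G F k) := by
  induction k with
  | zero => exact hF
  | succ k ih =>
    refine LipschitzWith.of_dist_le_mul fun c c' => ?_
    simp only [Hrec]
    rw [dist_eq_norm, ← integral_sub (integrable_lip_comp ν ih hG c)
      (integrable_lip_comp ν ih hG c')]
    have := norm_integral_le_of_norm_le_const (μ := ν)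
      (f := fun ω => Hrec ν G F k (c + G ω) - Hrec ν G F k (c' + G ω)) (C := C * dist c c') ?_
    · simpa using this
    · refine Filter.Eventually.of_forall fun ω => ?_
      have := ih.dist_le_mul (c + G ω) (c' + G ω)
      simpa [dist_eq_norm] using this

lemma Hrec_convex (ν : Measure Ω) [IsProbabilityMeasure ν] {F : E → ℝ} {C : NNReal}
    (hF : LipschitzWith C F) (hc : ConvexOn ℝ Set.univ F)
    {G : Ω → E} (hG : Integrable G ν) (k : ℕ) :
    ConvexOn ℝ Set.univ (Hrec ν G F k) := by
  induction k with
  | zero => exact hc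
  | succ k ih =>
    refine ⟨convex_univ, fun x _ y _ a b ha hb hab => ?_⟩
    have hl := Hrec_lip ν hF hG k
    simp only [Hrec, smul_eq_mul]
    rw [← integral_const_mul, ← integral_const_mul, ← integral_add
      ((integrable_lip_comp ν hl hG x).const_mul _) ((integrable_lip_comp ν hl hG y).const_mul _)]
    refine integral_mono (integrable_lip_comp ν hl hG _)
      (((integrable_lip_comp ν hl hG x).const_mul _).add
      ((integrable_lip_comp ν hl hG y).const_mul _)) fun ω => ?_
    have := ih.2 (Set.mem_univ (x + G ω)) (Set.mem_univ (y + G ω)) ha hb hab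
    have e : a • x + b • y + G ω = a • (x + G ω) + b • (y + G ω) := by
      rw [smul_add, smul_add]
      nth_rw 1 [← one_smul ℝ (G ω), ← hab]
      rw [add_smul]; abel
    rw [e]
    simpa using this

lemma Hrec_contr (ν : Measure Ω) [IsProbabilityMeasure ν] {F : E → ℝ} {C : NNReal}
    (hF : LipschitzWith C F) {g u : E}
    (hc : ∀ c, F (c + g) + F (c - g) ≤ F (c + u) + F (c - u))
    {G : Ω → E} (hG : Integrable G ν) (k : ℕ) :
    ∀ c, Hrec ν G F k (c + g) + Hrec ν G F k (c - g)
      ≤ Hrec ν G F k (c + u) + Hrec ν G F k (c - u) := by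
  induction k with
  | zero => exact hc
  | succ k ih =>
    intro c
    have hl := Hrec_lip ν hF hG k
    have hi := fun x => integrable_lip_comp ν hl hG x
    simp only [Hrec]
    rw [← integral_add (hi _) (hi _), ← integral_add (hi _) (hi _)]
    refine integral_mono ((hi _).add (hi _)) ((hi _).add (hi _)) fun ω => ?_
    have := ih (c + G ω)
    have e1 : ∀ v, c + v + G ω = c + G ω + v := fun v => by abel
    have e2 : ∀ v, c - v + G ω = c + G ω - v := fun v => by abel
    simp only [e1, e2]
    exact this

lemma Hrec_exists (ν : Measure Ω) [IsProbabilityMeasure ν] {F : E → ℝ} {C : NNReal}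
    (hF : LipschitzWith C F) {G : Ω → E} (hG : Integrable G ν) (k : ℕ) :
    ∀ c, ∃ θ : Fin k → Ω, F (c + ∑ j, G (θ j)) ≤ Hrec ν G F k c := by
  induction k with
  | zero => intro c; exact ⟨Fin.elim0, by simp [Hrec]⟩
  | succ k ih =>
    intro c
    obtain ⟨ω, hω⟩ := exists_le_integral
      (integrable_lip_comp ν (Hrec_lip ν hF hG k) hG c)
    obtain ⟨θ, hθ⟩ := ih (c + G ω)
    refine ⟨Fin.cons ω θ, ?_⟩
    rw [Fin.sum_univ_succ]
    simp only [Fin.cons_zero, Fin.cons_succ, ← add_assoc]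
    exact hθ.trans hω

/-- one symmetrization + contraction step -/
lemma Hrec_step [CompleteSpace E] (ν : Measure Ω) [IsProbabilityMeasure ν] {F : E → ℝ} {C : NNReal}
    (hF : LipschitzWith C F) (hcv : ConvexOn ℝ Set.univ F)
    {f u : Ω → E} (hf : Integrable f ν) (hu : Integrable u ν)
    (hc : ∀ ω c, F (c + (2:ℝ) • f ω) + F (c - (2:ℝ) • f ω)
       ≤ F (c + (2:ℝ) • u ω) + F (c - (2:ℝ) • u ω))
    (k : ℕ) (c : E) (B : ℝ)
    (hB : ∀ ω, (1/2) * (Hrec ν (fun ω => (∫ ω', f ω' ∂ν) - f ω) F k (c + (2:ℝ) • u ω)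
        + Hrec ν (fun ω => (∫ ω', f ω' ∂ν) - f ω) F k (c - (2:ℝ) • u ω)) ≤ B) :
    Hrec ν (fun ω => (∫ ω', f ω' ∂ν) - f ω) F (k + 1) c ≤ B := by
  set μ := ∫ ω', f ω' ∂ν with hμ
  set G : Ω → E := fun ω => μ - f ω with hGdef
  have hG : Integrable G ν := (integrable_const μ).sub hf
  set H := Hrec ν G F k with hH
  have hl : LipschitzWith C H := Hrec_lip ν hF hG k
  have hcx : ConvexOn ℝ Set.univ H := Hrec_convex ν hF hcv hG k
  have hi : ∀ {g : Ω → E}, Integrable g ν → Integrable (fun ω => H (c + g ω)) ν :=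
    fun hg => integrable_lip_comp ν hl hg c
  have hi' : ∀ {g : Ω → E}, Integrable g ν → Integrable (fun ω => H (c - g ω)) ν := by
    intro g hg
    simpa [sub_eq_add_neg] using hi hg.neg
  have h2f : Integrable (fun ω => (2:ℝ) • f ω) ν := hf.smul _
  have h2u : Integrable (fun ω => (2:ℝ) • u ω) ν := hu.smul _
  have hJ : H (c + (2:ℝ) • μ) ≤ ∫ ω, H (c + (2:ℝ) • f ω) ∂ν := by
    have := hcx.map_integral_le (μ := ν) (f := fun ω => c + (2:ℝ) • f ω)
      hl.continuous.continuousOn isClosed_univ (by simp)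
      ((integrable_const c).add h2f) (hi h2f)
    rw [integral_add (integrable_const c) h2f, integral_smul] at this
    simpa using this
  show ∫ ω, H (c + G ω) ∂ν ≤ _
  calc ∫ ω, H (c + G ω) ∂ν
      ≤ ∫ ω, ((1/2) * H (c + (2:ℝ) • μ) + (1/2) * H (c - (2:ℝ) • f ω)) ∂ν := by
        refine integral_mono (hi hG) ((integrable_const _).add ((hi' h2f).const_mul _)) fun ω => ?_
        have := hcx.2 (Set.mem_univ (c + (2:ℝ) • μ)) (Set.mem_univ (c - (2:ℝ) • f ω))
          (by norm_num : (0:ℝ) ≤ 1/2) (by norm_num : (0:ℝ) ≤ 1/2) (by norm_num)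
        have e : c + G ω = (1/2:ℝ) • (c + (2:ℝ) • μ) + (1/2:ℝ) • (c - (2:ℝ) • f ω) := by
          simp only [hGdef]; module
        rw [e]; simpa using this
    _ = (1/2) * H (c + (2:ℝ) • μ) + (1/2) * ∫ ω, H (c - (2:ℝ) • f ω) ∂ν := by
        rw [integral_add (integrable_const _) ((hi' h2f).const_mul _)]
        simp [integral_const_mul]
    _ ≤ (1/2) * (∫ ω, H (c + (2:ℝ) • f ω) ∂ν) + (1/2) * ∫ ω, H (c - (2:ℝ) • f ω) ∂ν := by
        gcongr
    _ = ∫ ω, (1/2) * (H (c + (2:ℝ) • f ω) + H (c - (2:ℝ) • f ω)) ∂ν := by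
        rw [integral_const_mul, integral_add (hi h2f) (hi' h2f)]; ring
    _ ≤ ∫ ω, (1/2) * (H (c + (2:ℝ) • u ω) + H (c - (2:ℝ) • u ω)) ∂ν := by
        refine integral_mono (((hi h2f).add (hi' h2f)).const_mul _)
          (((hi h2u).add (hi' h2u)).const_mul _) fun ω => ?_
        have := Hrec_contr ν hF (hc ω) hG k c
        simp only
        linarith
    _ ≤ ∫ _, B ∂ν :=
        integral_mono (((hi h2u).add (hi' h2u)).const_mul _) (integrable_const _) hB
    _ = B := by simp

end abstract_part

section supr
variable {K : Type*} [TopologicalSpace K] [CompactSpace K] [Nonempty K]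

lemma bdd_cm (c : C(K, ℝ)) : BddAbove (Set.range c) := (isCompact_range c.continuous).bddAbove

lemma sup_lip (ℓ : C(K, ℝ) →L[ℝ] ℝ) :
    LipschitzWith (1 + ‖ℓ‖₊) (fun c : C(K, ℝ) => (⨆ x, c x) - ℓ c) := by
  refine LipschitzWith.sub ?_ ℓ.lipschitz
  refine LipschitzWith.of_le_add fun c c' => ?_
  refine ciSup_le fun x => ?_
  have h1 := le_ciSup (bdd_cm c') x
  have h2 := (ContinuousMap.dist_apply_le_dist (f := c) (g := c') x)
  rw [Real.dist_eq] at h2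
  have := (abs_le.1 h2).2
  linarith

lemma sup_convex (ℓ : C(K, ℝ) →L[ℝ] ℝ) :
    ConvexOn ℝ Set.univ (fun c : C(K, ℝ) => (⨆ x, c x) - ℓ c) := by
  refine ⟨convex_univ, fun c _ c' _ a b ha hb hab => ?_⟩
  have : (⨆ x, (a • c + b • c') x) ≤ a * (⨆ x, c x) + b * (⨆ x, c' x) := by
    refine ciSup_le fun x => ?_
    have h1 := mul_le_mul_of_nonneg_left (le_ciSup (bdd_cm c) x) ha
    have h2 := mul_le_mul_of_nonneg_left (le_ciSup (bdd_cm c') x) hb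
    simp only [ContinuousMap.add_apply, ContinuousMap.smul_apply, smul_eq_mul]
    linarith
  simp only [map_add, map_smul, smul_eq_mul]
  linarith

lemma sup_contr (ℓ : C(K, ℝ) →L[ℝ] ℝ) (g u : C(K, ℝ)) (h : ∀ x y, |g x - g y| ≤ |u x - u y|)
    (c : C(K, ℝ)) :
    ((⨆ x, (c + g) x) - ℓ (c + g)) + ((⨆ x, (c - g) x) - ℓ (c - g)) ≤
    ((⨆ x, (c + u) x) - ℓ (c + u)) + ((⨆ x, (c - u) x) - ℓ (c - u)) := by
  have : (⨆ x, (c + g) x) + (⨆ x, (c - g) x) ≤ (⨆ x, (c + u) x) + (⨆ x, (c - u) x) := by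
    refine ciSup_add_ciSup_le fun x y => ?_
    have h1 : c x + u x ≤ ⨆ x, (c + u) x := le_ciSup (bdd_cm (c + u)) x
    have h2 : c y - u y ≤ ⨆ x, (c - u) x := le_ciSup (bdd_cm (c - u)) y
    have h3 : c y + u y ≤ ⨆ x, (c + u) x := le_ciSup (bdd_cm (c + u)) y
    have h4 : c x - u x ≤ ⨆ x, (c - u) x := le_ciSup (bdd_cm (c - u)) x
    simp only [ContinuousMap.add_apply, ContinuousMap.sub_apply] at *
    have h5 := (le_abs_self _).trans (h x y)
    rcases abs_cases (u x - u y) with h6 | h6 <;> linarith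
  simp only [map_add, map_sub]
  linarith
end supr

section concrete
variable {d : ℕ}

lemma cont_of_lip {σ : ℝ → ℝ} {Lσ : ℝ} (hLip : ∀ s t : ℝ, |σ s - σ t| ≤ Lσ * |s - t|) :
    Continuous σ := by
  have : LipschitzWith Lσ.toNNReal σ := LipschitzWith.of_dist_le_mul fun s t => by
    rw [Real.dist_eq, Real.dist_eq]
    exact (hLip s t).trans (mul_le_mul_of_nonneg_right (Real.le_coe_toNNReal _) (abs_nonneg _))
  exact this.continuous

/-- the neuron as an element of `C(K, ℝ)`, continuous in the parameters -/
noncomputable def neuron (σ : ℝ → ℝ) (hσ : Continuous σ) (K : Set (EuclideanSpace ℝ (Fin d))) :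
    C(ℝ × EuclideanSpace ℝ (Fin d) × ℝ, C(K, ℝ)) :=
  ContinuousMap.curry ⟨fun q : (ℝ × EuclideanSpace ℝ (Fin d) × ℝ) × K =>
    q.1.1 * σ (⟪q.1.2.1, (q.2 : EuclideanSpace ℝ (Fin d))⟫ + q.1.2.2), by fun_prop⟩

@[simp] lemma neuron_apply (σ : ℝ → ℝ) (hσ : Continuous σ) (K : Set (EuclideanSpace ℝ (Fin d)))
    (θ : ℝ × EuclideanSpace ℝ (Fin d) × ℝ) (x : K) :
    neuron σ hσ K θ x = θ.1 * σ (⟪θ.2.1, (x : EuclideanSpace ℝ (Fin d))⟫ + θ.2.2) := rfl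

noncomputable def lin (K : Set (EuclideanSpace ℝ (Fin d))) (w : EuclideanSpace ℝ (Fin d)) (b : ℝ) :
    C(K, ℝ) := ⟨fun x => ⟪w, (x : EuclideanSpace ℝ (Fin d))⟫ + b, by fun_prop⟩

@[simp] lemma lin_apply (K : Set (EuclideanSpace ℝ (Fin d))) (w : EuclideanSpace ℝ (Fin d)) (b : ℝ)
    (x : K) : lin K w b x = ⟪w, (x : EuclideanSpace ℝ (Fin d))⟫ + b := rfl

lemma affine_le {w x : EuclideanSpace ℝ (Fin d)} {b R : ℝ} (hx : ‖x‖ ≤ R) :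
    |⟪w, x⟫ + b| ≤ √(R ^ 2 + 1) * √(‖w‖ ^ 2 + b ^ 2) := by
  have h1 : |⟪w, x⟫| ≤ ‖w‖ * R :=
    (abs_real_inner_le_norm w x).trans (mul_le_mul_of_nonneg_left hx (norm_nonneg _))
  rw [← Real.sqrt_mul (by positivity)]
  refine Real.le_sqrt_of_sq_le ?_
  have h2 : |⟪w, x⟫ + b| ≤ ‖w‖ * R + |b| := (abs_add_le _ _).trans (by gcongr)
  have h3 : |⟪w, x⟫ + b| ^ 2 ≤ (‖w‖ * R + |b|) ^ 2 := by gcongr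
  nlinarith [sq_nonneg (‖w‖ - R * |b|), sq_abs b]

lemma sqrt_avg {p q : ℝ} (hp : 0 ≤ p) (hq : 0 ≤ q) :
    1 / 2 * (√p + √q) ≤ √((p + q) / 2) := by
  refine Real.le_sqrt_of_sq_le ?_
  nlinarith [Real.sq_sqrt hp, Real.sq_sqrt hq, sq_nonneg (√p - √q)]

lemma neuron_bound {σ : ℝ → ℝ} {Lσ : ℝ} (hLσ : 0 ≤ Lσ)
    (hLip : ∀ s t : ℝ, |σ s - σ t| ≤ Lσ * |s - t|) (hσ0 : σ 0 = 0)
    {x : EuclideanSpace ℝ (Fin d)} {R : ℝ} (hx : ‖x‖ ≤ R)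
    (θ : ℝ × EuclideanSpace ℝ (Fin d) × ℝ) :
    |θ.1 * σ (⟪θ.2.1, x⟫ + θ.2.2)| ≤
      Lσ * √(R ^ 2 + 1) * (|θ.1| * √(‖θ.2.1‖ ^ 2 + θ.2.2 ^ 2)) := by
  have h1 := hLip (⟪θ.2.1, x⟫ + θ.2.2) 0
  rw [hσ0, sub_zero, sub_zero] at h1
  have h2 := affine_le (w := θ.2.1) (b := θ.2.2) hx
  rw [abs_mul]
  calc |θ.1| * |σ (⟪θ.2.1, x⟫ + θ.2.2)|
      ≤ |θ.1| * (Lσ * (√(R ^ 2 + 1) * √(‖θ.2.1‖ ^ 2 + θ.2.2 ^ 2))) := by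
        gcongr; exact h1.trans (by gcongr)
    _ = _ := by ring

lemma main_bound {Ω : Type*} [MeasurableSpace Ω] (ν : Measure Ω) [IsProbabilityMeasure ν]
    {σ : ℝ → ℝ} {Lσ : ℝ} (hLσ : 0 ≤ Lσ)
    (hLip : ∀ s t : ℝ, |σ s - σ t| ≤ Lσ * |s - t|) (hσ0 : σ 0 = 0) (hσ : Continuous σ)
    {R : ℝ} (hR : 0 ≤ R) {M₁ : ℝ} (hM₁ : 0 ≤ M₁)
    (g : Ω → ℝ × EuclideanSpace ℝ (Fin d) × ℝ) (hg : Measurable g)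
    (hb : ∀ ω, |(g ω).1| * √(‖(g ω).2.1‖ ^ 2 + (g ω).2.2 ^ 2) ≤ M₁)
    (ℓ : C(Metric.closedBall (0 : EuclideanSpace ℝ (Fin d)) R, ℝ) →L[ℝ] ℝ) :
    Integrable (fun ω => neuron σ hσ (Metric.closedBall 0 R) (g ω)) ν ∧
    ∀ (k : ℕ) (w : EuclideanSpace ℝ (Fin d)) (b : ℝ),
      Hrec ν (fun ω => (∫ ω', neuron σ hσ (Metric.closedBall 0 R) (g ω') ∂ν)
          - neuron σ hσ (Metric.closedBall 0 R) (g ω))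
        (fun c => (⨆ x, c x) - ℓ c) k (lin _ w b) ≤
      √(R ^ 2 + 1) * √(‖w‖ ^ 2 + b ^ 2 + 4 * k * (Lσ * M₁) ^ 2) - ℓ (lin _ w b) := by
  have hne : Nonempty (Metric.closedBall (0 : EuclideanSpace ℝ (Fin d)) R) :=
    ⟨⟨0, by simpa using hR⟩⟩
  have hcpt : CompactSpace (Metric.closedBall (0 : EuclideanSpace ℝ (Fin d)) R) :=
    isCompact_iff_compactSpace.1 (isCompact_closedBall _ _)
  have hmem : ∀ x : Metric.closedBall (0 : EuclideanSpace ℝ (Fin d)) R,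
      ‖(x : EuclideanSpace ℝ (Fin d))‖ ≤ R := fun x =>
    mem_closedBall_zero_iff.1 x.2
  have hint : ∀ {τ : ℝ → ℝ} (T : ℝ) (hT : 0 ≤ T) (hτ : Continuous τ)
      (_ : ∀ s t : ℝ, |τ s - τ t| ≤ T * |s - t|) (_ : τ 0 = 0),
      Integrable (fun ω => neuron τ hτ (Metric.closedBall 0 R) (g ω)) ν := by
    intro τ T hT hτ hτL hτ0
    refine (integrable_const (T * √(R ^ 2 + 1) * M₁)).mono' ?_ ?_
    · exact ((neuron τ hτ (Metric.closedBall 0 R)).continuous.stronglyMeasurable.comp_measurable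
        hg).aestronglyMeasurable
    · refine Filter.Eventually.of_forall fun ω => ?_
      rw [ContinuousMap.norm_le _ (by positivity)]
      intro x
      rw [neuron_apply, Real.norm_eq_abs]
      refine (neuron_bound hT hτL hτ0 (hmem x) (g ω)).trans ?_
      exact mul_le_mul_of_nonneg_left (hb ω) (by positivity)
  have hf := hint Lσ hLσ hσ hLip hσ0
  refine ⟨hf, ?_⟩
  have hu := (hint 1 zero_le_one continuous_id (by simp) rfl).smul Lσ
  set μ := ∫ ω', neuron σ hσ (Metric.closedBall 0 R) (g ω') ∂ν
  intro k
  induction k with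
  | zero =>
    intro w b
    simp only [Hrec, CharP.cast_eq_zero, mul_zero, zero_mul, add_zero]
    refine sub_le_sub_right (ciSup_le fun x => ?_) _
    exact (le_abs_self _).trans (affine_le (hmem x))
  | succ k ih =>
    intro w b
    refine Hrec_step ν (sup_lip ℓ) (sup_convex ℓ) hf hu ?_ k (lin _ w b) _ ?_
    · intro ω c
      refine sup_contr ℓ _ _ (fun x y => ?_) c
      simp only [ContinuousMap.smul_apply, neuron_apply, smul_eq_mul, Pi.smul_apply, id]
      have h1 := hLip (⟪(g ω).2.1, (x : EuclideanSpace ℝ (Fin d))⟫ + (g ω).2.2)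
        (⟪(g ω).2.1, (y : EuclideanSpace ℝ (Fin d))⟫ + (g ω).2.2)
      rw [← mul_sub, ← mul_sub, ← mul_sub, ← mul_sub, ← mul_sub, abs_mul, abs_mul, abs_mul,
        abs_mul, abs_mul, abs_of_nonneg hLσ]
      calc _ ≤ |(2:ℝ)| * (|(g ω).1| * (Lσ * _)) := by gcongr
        _ = _ := by ring
    · intro ω
      obtain ⟨a, w', b', hgω⟩ : ∃ a w' b', g ω = (a, w', b') := ⟨_, _, _, rfl⟩
      have hbω := hb ω
      rw [hgω] at hbω
      simp only at hbω
      have e1 : lin (Metric.closedBall (0 : EuclideanSpace ℝ (Fin d)) R) w b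
          + (2:ℝ) • (Lσ • fun ω =>
            neuron id continuous_id (Metric.closedBall 0 R) (g ω)) ω =
          lin _ (w + (2 * Lσ * a) • w') (b + 2 * Lσ * a * b') := by
        ext x
        simp [hgω, inner_add_left, inner_smul_left]; ring
      have e2 : lin (Metric.closedBall (0 : EuclideanSpace ℝ (Fin d)) R) w b
          - (2:ℝ) • (Lσ • fun ω =>
            neuron id continuous_id (Metric.closedBall 0 R) (g ω)) ω =
          lin _ (w - (2 * Lσ * a) • w') (b - 2 * Lσ * a * b') := by
        ext x
        simp [hgω, inner_sub_left, inner_smul_left]; ring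
      have e3 : ℓ (lin _ (w + (2 * Lσ * a) • w') (b + 2 * Lσ * a * b'))
          + ℓ (lin _ (w - (2 * Lσ * a) • w') (b - 2 * Lσ * a * b')) = 2 * ℓ (lin _ w b) := by
        rw [← e1, ← e2, map_add, map_sub]; ring
      have i1 := ih (w + (2 * Lσ * a) • w') (b + 2 * Lσ * a * b')
      have i2 := ih (w - (2 * Lσ * a) • w') (b - 2 * Lσ * a * b')
      rw [e1, e2]
      set p := ‖w + (2 * Lσ * a) • w'‖ ^ 2 + (b + 2 * Lσ * a * b') ^ 2
        + 4 * k * (Lσ * M₁) ^ 2 with hp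
      set q := ‖w - (2 * Lσ * a) • w'‖ ^ 2 + (b - 2 * Lσ * a * b') ^ 2
        + 4 * k * (Lσ * M₁) ^ 2 with hq
      have hs := sqrt_avg (p := p) (q := q) (by positivity) (by positivity)
      have hpq : (p + q) / 2 ≤ ‖w‖ ^ 2 + b ^ 2 + 4 * (k + 1 : ℕ) * (Lσ * M₁) ^ 2 := by
        have hpar := parallelogram_law_with_norm ℝ w ((2 * Lσ * a) • w')
        have hn : ‖(2 * Lσ * a) • w'‖ ^ 2 = 4 * Lσ ^ 2 * a ^ 2 * ‖w'‖ ^ 2 := by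
          rw [norm_smul, mul_pow, Real.norm_eq_abs, sq_abs]; ring
        have hsq : a ^ 2 * (‖w'‖ ^ 2 + b' ^ 2) ≤ M₁ ^ 2 := by
          have := pow_le_pow_left₀ (by positivity) hbω 2
          rwa [mul_pow, sq_abs, Real.sq_sqrt (by positivity)] at this
        have := mul_le_mul_of_nonneg_left hsq (sq_nonneg Lσ)
        push_cast
        rw [hp, hq]
        nlinarith
      have hs2 := mul_le_mul_of_nonneg_left (hs.trans (Real.sqrt_le_sqrt hpq))
        (Real.sqrt_nonneg (R ^ 2 + 1))
      linarith

end concrete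

section klpart

lemma kl_bound {X : Type*} [MeasurableSpace X] (P : Measure X) [IsProbabilityMeasure P]
    {V W : X → ℝ} (hV : Measurable V) (hW : Measurable W) {C s : ℝ}
    (hVb : ∀ᵐ x ∂P, |V x| ≤ C) (hWb : ∀ᵐ x ∂P, |W x| ≤ C) (hs : ∀ᵐ x ∂P, V x - W x ≤ s) :
    IsProbabilityMeasure (gibbs P V) ∧ gibbs P V ≪ P ∧
    klDiv (gibbs P V) (gibbs P W) ≤ s - ∫ x, (V x - W x) ∂(gibbs P V) := by
  have hexp : ∀ {U : X → ℝ}, Measurable U → (∀ᵐ x ∂P, |U x| ≤ C) →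
      Integrable (fun x => Real.exp (-U x)) P := by
    intro U hU hUb
    refine (integrable_const (Real.exp C)).mono' (by fun_prop) ?_
    filter_upwards [hUb] with x hx
    rw [Real.norm_eq_abs, abs_of_pos (Real.exp_pos _)]
    exact Real.exp_le_exp.2 (by linarith [(abs_le.1 hx).1])
  have hiV := hexp hV hVb
  have hiW := hexp hW hWb
  have gV : gibbs P V = P.tilted (fun x => -V x) := rfl
  have gW : gibbs P W = P.tilted (fun x => -W x) := rfl
  have pV : IsProbabilityMeasure (gibbs P V) := by
    rw [gV]; exact isProbabilityMeasure_tilted hiV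
  have pW : IsProbabilityMeasure (gibbs P W) := by
    rw [gW]; exact isProbabilityMeasure_tilted hiW
  have acV : gibbs P V ≪ P := by rw [gV]; exact tilted_absolutelyContinuous _ _
  have acW : gibbs P W ≪ P := by rw [gW]; exact tilted_absolutelyContinuous _ _
  have acVW : gibbs P V ≪ gibbs P W := by
    rw [gW]; exact acV.trans (absolutelyContinuous_tilted hiW)
  refine ⟨pV, acV, ?_⟩
  have ht : gibbs P V = (gibbs P W).tilted (fun x => W x - V x) := by
    rw [gW, tilted_tilted hiW, gV]
    congr 1; ext x; simp only [Pi.add_apply]; ring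
  have hie : Integrable (fun x => Real.exp (W x - V x)) (gibbs P W) := by
    refine (integrable_const (Real.exp (2 * C))).mono' (by fun_prop) ?_
    filter_upwards [acW.ae_le hWb, acW.ae_le hVb] with x h1 h2
    rw [Real.norm_eq_abs, abs_of_pos (Real.exp_pos _)]
    exact Real.exp_le_exp.2 (by linarith [(abs_le.1 h1).2, (abs_le.1 h2).1])
  have hlog := log_rnDeriv_tilted_left_self hie
  rw [← ht] at hlog
  have hlog' := acVW.ae_le hlog
  have hid : Integrable (fun x => V x - W x) (gibbs P V) := by
    refine (integrable_const (2 * C)).mono' (by fun_prop) ?_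
    filter_upwards [acV.ae_le hWb, acV.ae_le hVb] with x h1 h2
    rw [Real.norm_eq_abs]
    exact (abs_sub _ _).trans (by linarith)
  have hlow : -s ≤ Real.log (∫ x, Real.exp (W x - V x) ∂(gibbs P W)) := by
    have h1 : Real.exp (-s) ≤ ∫ x, Real.exp (W x - V x) ∂(gibbs P W) := by
      have : ∫ _, Real.exp (-s) ∂(gibbs P W) ≤ ∫ x, Real.exp (W x - V x) ∂(gibbs P W) := by
        refine integral_mono_ae (integrable_const _) hie ?_
        filter_upwards [acW.ae_le hs] with x hx
        exact Real.exp_le_exp.2 (by linarith)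
      simpa using this
    have := Real.log_le_log (Real.exp_pos _) h1
    rwa [Real.log_exp] at this
  unfold klDiv
  rw [integral_congr_ae hlog']
  have e : ∀ x, W x - V x - Real.log (∫ x, Real.exp (W x - V x) ∂(gibbs P W))
    = -(V x - W x) - Real.log (∫ x, Real.exp (W x - V x) ∂(gibbs P W)) := fun x => by ring
  simp_rw [e]
  have hid2 : Integrable (fun x => -(V x - W x)) (gibbs P V) := hid.neg
  rw [integral_sub hid2 (integrable_const _)]
  rw [integral_neg]
  simp only [integral_const, probReal_univ, one_smul]
  linarith

/-- integration as a functional on `C(K, ℝ)` -/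
lemma exists_ell {K : Type*} [TopologicalSpace K] [CompactSpace K] [MeasurableSpace K]
    [BorelSpace K] (Q : Measure K) [IsFiniteMeasure Q] :
    ∃ ℓ : C(K, ℝ) →L[ℝ] ℝ, ∀ c, ℓ c = ∫ x, c x ∂Q := by
  have hi : ∀ c : C(K, ℝ), Integrable c Q := fun c =>
    (integrable_const ‖c‖).mono' c.continuous.measurable.aestronglyMeasurable
      (Filter.Eventually.of_forall fun x => c.norm_coe_le_norm x)
  refine ⟨LinearMap.mkContinuous
    { toFun := fun c => ∫ x, c x ∂Q
      map_add' := fun c c' => integral_add (hi c) (hi c')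
      map_smul' := fun a c => integral_const_mul a _ } (Q.real Set.univ) fun c => ?_, fun c => rfl⟩
  have := norm_integral_le_of_norm_le_const (μ := Q) (f := c) (C := ‖c‖)
    (Filter.Eventually.of_forall fun x => c.norm_coe_le_norm x)
  simpa [mul_comm] using this

lemma exists_resample {d : ℕ}
    (ρ : Measure (ℝ × EuclideanSpace ℝ (Fin d) × ℝ)) [IsProbabilityMeasure ρ]
    (hInt : Integrable (fun p : ℝ × EuclideanSpace ℝ (Fin d) × ℝ =>
      p.1 ^ 2 * (‖p.2.1‖ ^ 2 + p.2.2 ^ 2)) ρ)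
    (M : ℝ) (hM0 : 0 ≤ M)
    (hM : M ^ 2 = ∫ p : ℝ × EuclideanSpace ℝ (Fin d) × ℝ,
      p.1 ^ 2 * (‖p.2.1‖ ^ 2 + p.2.2 ^ 2) ∂ρ) :
    ∃ (ν : Measure (ℝ × EuclideanSpace ℝ (Fin d) × ℝ))
      (g : ℝ × EuclideanSpace ℝ (Fin d) × ℝ → ℝ × EuclideanSpace ℝ (Fin d) × ℝ),
      IsProbabilityMeasure ν ∧ Measurable g ∧
      (∀ ω, |(g ω).1| * √(‖(g ω).2.1‖ ^ 2 + (g ω).2.2 ^ 2) ≤ M) ∧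
      ∀ (σ : ℝ → ℝ) (Lσ : ℝ), 0 ≤ Lσ → (∀ s t : ℝ, |σ s - σ t| ≤ Lσ * |s - t|) → σ 0 = 0 →
        ∀ x : EuclideanSpace ℝ (Fin d),
        ∫ p, (g p).1 * σ (⟪(g p).2.1, x⟫ + (g p).2.2) ∂ν =
          ∫ p, p.1 * σ (⟪p.2.1, x⟫ + p.2.2) ∂ρ := by
  set h : ℝ × EuclideanSpace ℝ (Fin d) × ℝ → ℝ :=
    fun p => |p.1| * √(‖p.2.1‖ ^ 2 + p.2.2 ^ 2) with hh
  have hmeas : Measurable h := by fun_prop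
  have h0 : ∀ p, 0 ≤ h p := fun p => by positivity
  have hsq : ∀ p, h p ^ 2 = p.1 ^ 2 * (‖p.2.1‖ ^ 2 + p.2.2 ^ 2) := fun p => by
    simp only [hh]; rw [mul_pow, sq_abs, Real.sq_sqrt (by positivity)]
  simp_rw [← hsq] at hInt hM
  have hi : Integrable h ρ := by
    refine (((integrable_const (1:ℝ)).add hInt)).mono' hmeas.aestronglyMeasurable ?_
    refine Filter.Eventually.of_forall fun p => ?_
    simp only [Real.norm_eq_abs, Pi.add_apply]
    rw [abs_of_nonneg (h0 p)]
    nlinarith [sq_nonneg (h p - 1)]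
  set M₁ := ∫ p, h p ∂ρ with hM₁
  have hM₁0 : 0 ≤ M₁ := integral_nonneg h0
  have hM₁M : M₁ ≤ M := by
    have : 0 ≤ ∫ p, (h p - M₁) ^ 2 ∂ρ := integral_nonneg fun p => sq_nonneg _
    have e : ∀ p, (h p - M₁) ^ 2 = h p ^ 2 - 2 * M₁ * h p + M₁ ^ 2 := fun p => by ring
    simp_rw [e] at this
    have hsub : Integrable (fun p => h p ^ 2 - 2 * M₁ * h p) ρ := hInt.sub (hi.const_mul _)
    rw [integral_add hsub (integrable_const _),
      integral_sub hInt (hi.const_mul _), integral_const_mul, ← hM, ← hM₁] at this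
    simp only [integral_const, probReal_univ, one_smul] at this
    nlinarith
  have hz : ∀ p, h p = 0 → ∀ (σ : ℝ → ℝ) (Lσ : ℝ), 0 ≤ Lσ →
      (∀ s t : ℝ, |σ s - σ t| ≤ Lσ * |s - t|) → σ 0 = 0 →
      ∀ x : EuclideanSpace ℝ (Fin d), p.1 * σ (⟪p.2.1, x⟫ + p.2.2) = 0 := by
    intro p hp σ Lσ hL hLip hσ0 x
    have := neuron_bound hL hLip hσ0 (le_refl ‖x‖) p
    change _ ≤ _ * h p at this
    rw [hp, mul_zero] at this
    exact abs_eq_zero.1 (le_antisymm this (abs_nonneg _))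
  rcases hM₁0.eq_or_lt with hM10 | hpos
  · refine ⟨ρ, fun p => (0, p.2), inferInstance, by fun_prop, fun ω => by simpa using hM0, ?_⟩
    intro σ Lσ hL hLip hσ0 x
    refine integral_congr_ae ?_
    have : h =ᵐ[ρ] 0 := (integral_eq_zero_iff_of_nonneg h0 hi).1 hM10.symm
    filter_upwards [this] with p hp
    rw [hz p hp σ Lσ hL hLip hσ0 x]; simp
  · refine ⟨ρ.withDensity fun p => ENNReal.ofReal (h p / M₁), fun p => (p.1 * M₁ / h p, p.2),
      ⟨?_⟩, by fun_prop, ?_, ?_⟩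
    · rw [withDensity_apply _ MeasurableSet.univ, Measure.restrict_univ,
        ← ofReal_integral_eq_lintegral_ofReal (hi.div_const _)
          (Filter.Eventually.of_forall fun p => div_nonneg (h0 p) hM₁0), integral_div, ← hM₁,
        div_self hpos.ne', ENNReal.ofReal_one]
    · intro p
      simp only
      have : |p.1 * M₁ / h p| * √(‖p.2.1‖ ^ 2 + p.2.2 ^ 2) = M₁ * (h p / h p) := by
        rw [abs_div, abs_mul, abs_of_nonneg hM₁0, abs_of_nonneg (h0 p)]
        simp only [hh]; ring
      rw [this]
      exact (mul_le_of_le_one_right hM₁0 (div_self_le_one _)).trans hM₁M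
    · intro σ Lσ hL hLip hσ0 x
      rw [integral_withDensity_eq_integral_toReal_smul (by fun_prop)
        (Filter.Eventually.of_forall fun p => ENNReal.ofReal_lt_top)]
      refine integral_congr_ae (Filter.Eventually.of_forall fun p => ?_)
      simp only [smul_eq_mul]
      rw [ENNReal.toReal_ofReal (div_nonneg (h0 p) hM₁0)]
      by_cases hp : h p = 0
      · rw [hz p hp σ Lσ hL hLip hσ0 x, hp]; simp
      · field_simp

end klpart

/-- **efficient approximation by finite two-layer networks.**
Let `σ` be Lipschitz with `σ(0) = 0`, let `P` be supported in the ball of radius `R`, and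
let `V(x) = ∫ a σ(w·x+b) dρ(a,w,b)` be a continuous two-layer network with path norm `M`.
Then for every `m` there are `m` neurons `(a_j, w_j, b_j)` such that the finite network
`V_m(x) = (1/m) ∑_j a_j σ(w_j·x+b_j)` satisfies
`KL(Q_V ‖ Q_{V_m}) ≤ 2√3 Lip(σ) √(R²+1) M / √m` and
`(1/m) ∑_j a_j²(‖w_j‖²+b_j²) ≤ 2M²`. -/
theorem efficient_approximation {d : ℕ}
    (σ : ℝ → ℝ) (Lσ : ℝ) (hLσ : 0 ≤ Lσ)
    (hLip : ∀ s t : ℝ, |σ s - σ t| ≤ Lσ * |s - t|) (hσ0 : σ 0 = 0)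
    (P : Measure (EuclideanSpace ℝ (Fin d))) [IsProbabilityMeasure P]
    (R : ℝ) (hR : 0 ≤ R) (hPsupp : P (Metric.closedBall 0 R)ᶜ = 0)
    (ρ : Measure (ℝ × EuclideanSpace ℝ (Fin d) × ℝ)) [IsProbabilityMeasure ρ]
    (hInt : Integrable (fun p : ℝ × EuclideanSpace ℝ (Fin d) × ℝ =>
      p.1 ^ 2 * (‖p.2.1‖ ^ 2 + p.2.2 ^ 2)) ρ)
    (M : ℝ) (hM0 : 0 ≤ M)
    (hM : M ^ 2 = ∫ p : ℝ × EuclideanSpace ℝ (Fin d) × ℝ,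
      p.1 ^ 2 * (‖p.2.1‖ ^ 2 + p.2.2 ^ 2) ∂ρ)
    (V : EuclideanSpace ℝ (Fin d) → ℝ)
    (hV : ∀ x, V x = ∫ p : ℝ × EuclideanSpace ℝ (Fin d) × ℝ,
      p.1 * σ (⟪p.2.1, x⟫ + p.2.2) ∂ρ)
    (m : ℕ) (hm : 0 < m) :
    ∃ θ : Fin m → ℝ × EuclideanSpace ℝ (Fin d) × ℝ,
      klDiv (gibbs P V)
          (gibbs P fun x => (1 / (m : ℝ)) * ∑ j, (θ j).1 * σ (⟪(θ j).2.1, x⟫ + (θ j).2.2))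
        ≤ 2 * Real.sqrt 3 * Lσ * Real.sqrt (R ^ 2 + 1) * M / Real.sqrt m ∧
      (1 / (m : ℝ)) * ∑ j, (θ j).1 ^ 2 * (‖(θ j).2.1‖ ^ 2 + (θ j).2.2 ^ 2) ≤ 2 * M ^ 2 := by
  have hσ : Continuous σ := cont_of_lip hLip
  obtain ⟨ν, g, hν, hg, hgb, hgV⟩ := exists_resample ρ hInt M hM0 hM
  have hgVx := hgV σ Lσ hLσ hLip hσ0
  set S := Metric.closedBall (0 : EuclideanSpace ℝ (Fin d)) R with hS
  have hne : Nonempty S := ⟨⟨0, by simpa [hS] using hR⟩⟩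
  have hcpt : CompactSpace S := isCompact_iff_compactSpace.1 (isCompact_closedBall _ _)
  have hSm : MeasurableSet S := Metric.isClosed_closedBall.measurableSet
  have hPS : ∀ᵐ x ∂P, x ∈ S := hPsupp
  have hnorm : ∀ x ∈ S, ‖x‖ ≤ R := fun x hx => mem_closedBall_zero_iff.1 hx
  have hVm : Measurable V := by
    have : V = fun x => ∫ p : ℝ × EuclideanSpace ℝ (Fin d) × ℝ,
      p.1 * σ (⟪p.2.1, x⟫ + p.2.2) ∂ρ := funext hV
    rw [this]
    refine StronglyMeasurable.measurable ?_
    refine StronglyMeasurable.integral_prod_right' (f := fun q : EuclideanSpace ℝ (Fin d) ×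
      (ℝ × EuclideanSpace ℝ (Fin d) × ℝ) => q.2.1 * σ (⟪q.2.2.1, q.1⟫ + q.2.2.2)) ?_
    exact Continuous.stronglyMeasurable (by fun_prop)
  set C := Lσ * √(R ^ 2 + 1) * M with hC
  have hgn : ∀ ω, ∀ x ∈ S, |(g ω).1 * σ (⟪(g ω).2.1, x⟫ + (g ω).2.2)| ≤ C := fun ω x hx =>
    (neuron_bound hLσ hLip hσ0 (hnorm x hx) (g ω)).trans
      (mul_le_mul_of_nonneg_left (hgb ω) (by positivity))
  have hVb : ∀ x ∈ S, |V x| ≤ C := by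
    intro x hx
    rw [hV, ← hgVx x]
    have := norm_integral_le_of_norm_le_const (μ := ν)
      (f := fun p => (g p).1 * σ (⟪(g p).2.1, x⟫ + (g p).2.2)) (C := C)
      (Filter.Eventually.of_forall fun p => hgn p x hx)
    simpa using this
  have hm' : (0:ℝ) < m := by exact_mod_cast hm
  have base := kl_bound P hVm hVm (s := 0) (hPS.mono hVb) (hPS.mono hVb) (by simp)
  have hQ := base.1
  have hac := base.2.1
  have hfin : IsFiniteMeasure (Measure.comap (Subtype.val : S → _) (gibbs P V)) := by
    refine ⟨?_⟩
    rw [(MeasurableEmbedding.subtype_coe hSm).comap_apply]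
    exact measure_lt_top _ _
  obtain ⟨ℓ, hℓ⟩ := exists_ell (Measure.comap (Subtype.val : S → _) (gibbs P V))
  obtain ⟨hfint, hbd⟩ := main_bound ν hLσ hLip hσ0 hσ hR hM0 g hg hgb ℓ
  set f : _ → C(S, ℝ) := fun ω => neuron σ hσ S (g ω) with hf
  set μ := ∫ ω', f ω' ∂ν with hμ
  have hμV : ∀ x : S, μ x = V x := by
    intro x
    rw [hV, ← hgVx x, hμ]
    exact ((ContinuousMap.evalCLM ℝ x).integral_comp_comm hfint).symm
  obtain ⟨θ, hθ⟩ := Hrec_exists ν (sup_lip ℓ) ((integrable_const μ).sub hfint) m (lin S 0 0)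
  have hθ2 := hθ.trans (hbd m 0 0)
  have hlin0 : lin S 0 0 = 0 := by ext x; simp
  rw [hlin0, zero_add, map_zero, sub_zero] at hθ2
  set D : C(S, ℝ) := ∑ j, (μ - f (θ j)) with hD
  refine ⟨fun j => g (θ j), ?_, ?_⟩
  · set W : EuclideanSpace ℝ (Fin d) → ℝ := fun x => (1 / (m : ℝ)) * ∑ j,
      (g (θ j)).1 * σ (⟪(g (θ j)).2.1, x⟫ + (g (θ j)).2.2) with hW
    have hWm : Measurable W := Continuous.measurable (by fun_prop)
    have hWb : ∀ x ∈ S, |W x| ≤ C := by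
      intro x hx
      simp only [hW]
      rw [abs_mul, abs_of_pos (by positivity : (0:ℝ) < 1 / m)]
      have h1 : |∑ j, (g (θ j)).1 * σ (⟪(g (θ j)).2.1, x⟫ + (g (θ j)).2.2)| ≤ m * C := by
        refine (Finset.abs_sum_le_sum_abs _ _).trans
          ((Finset.sum_le_sum fun j _ => hgn (θ j) x hx).trans ?_)
        simp
      calc _ ≤ 1 / (m:ℝ) * (m * C) := by gcongr
        _ = C := by field_simp
    have hDx : ∀ x : S, V x - W x = (1 / (m:ℝ)) * D x := by
      intro x
      have : D x = m * V x - ∑ j, (g (θ j)).1 * σ (⟪(g (θ j)).2.1, (x:EuclideanSpace ℝ (Fin d))⟫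
          + (g (θ j)).2.2) := by
        rw [hD, ContinuousMap.sum_apply]
        simp only [ContinuousMap.sub_apply, hμV, Finset.sum_sub_distrib, hf, neuron_apply]
        simp
      rw [this, hW]
      field_simp
    have hkl := (kl_bound P hVm hWm (s := (1 / (m:ℝ)) * ⨆ x, D x)
      (hPS.mono hVb) (hPS.mono hWb) ?_).2.2
    · refine hkl.trans ?_
      have hI : ∫ x, (V x - W x) ∂(gibbs P V) = (1 / (m:ℝ)) * ℓ D := by
        have hQS : ∀ᵐ x ∂(gibbs P V), x ∈ S := hac.ae_le hPS
        rw [← Measure.restrict_eq_self_of_ae_mem hQS, ← integral_subtype_comap hSm, hℓ,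
          ← integral_const_mul]
        exact integral_congr_ae (Filter.Eventually.of_forall hDx)
      rw [hI]
      have e1 : √(‖(0 : EuclideanSpace ℝ (Fin d))‖ ^ 2 + 0 ^ 2 + 4 * m * (Lσ * M) ^ 2)
          = 2 * √m * (Lσ * M) := by
        have : ‖(0 : EuclideanSpace ℝ (Fin d))‖ ^ 2 + (0:ℝ) ^ 2 + 4 * m * (Lσ * M) ^ 2
          = (2 * √m * (Lσ * M)) ^ 2 := by
          rw [mul_pow (2 * √(m:ℝ)), mul_pow 2 (√(m:ℝ)), Real.sq_sqrt hm'.le, norm_zero]; ring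
        rw [this, Real.sqrt_sq (by positivity)]
      rw [e1] at hθ2
      have h3 : 1 ≤ √(3:ℝ) := Real.one_le_sqrt.2 (by norm_num)
      calc _ = (1 / (m:ℝ)) * ((⨆ x, D x) - ℓ D) := by ring
        _ ≤ (1 / (m:ℝ)) * (√(R ^ 2 + 1) * (2 * √m * (Lσ * M))) := by gcongr; exact hθ2
        _ = 2 * 1 * Lσ * √(R ^ 2 + 1) * M / √m := by
          have : (m:ℝ) = √m * √m := (Real.mul_self_sqrt hm'.le).symm
          have hs : 0 < √(m:ℝ) := Real.sqrt_pos.2 hm'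
          nth_rw 1 [this]
          field_simp
        _ ≤ _ := by gcongr
    · filter_upwards [hPS] with x hx
      have := hDx ⟨x, hx⟩
      simp only at this
      rw [this]
      gcongr
      exact le_ciSup (bdd_cm D) ⟨x, hx⟩
  · have h1 : ∀ ω, (g ω).1 ^ 2 * (‖(g ω).2.1‖ ^ 2 + (g ω).2.2 ^ 2) ≤ M ^ 2 := fun ω => by
      have := pow_le_pow_left₀ (by positivity) (hgb ω) 2
      rwa [mul_pow, sq_abs, Real.sq_sqrt (by positivity)] at this
    calc _ ≤ (1 / (m:ℝ)) * ∑ _j : Fin m, M ^ 2 := by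
          gcongr with j; exact h1 (θ j)
      _ = M ^ 2 := by simp; field_simp
      _ ≤ _ := by nlinarith [sq_nonneg M]
end

section
/- Let K ⊆ ℝ^d be compact, k a continuous kernel on K, and Q' a Borel probability measure on K. For Q ∈ P(K) define v(x; Q) = ∫ k(x,x') d(Q' − Q)(x') and v̄(x; Q) = v(x; Q) − ∫ v(x'; Q) dQ(x'). Then for every initial Q_0 ∈ P(K) there exists a unique weakly continuous family (Q_t)_{t ≥ 0} ⊂ P(K) with Q_{t=0} = Q_0 such that for every continuous function f on K, the map t ↦ ∫ f dQ_t is differentiable with derivative (d/dt) ∫ f dQ_t = ∫ f(x) v̄(x; Q_t) dQ_t(x) for all t ≥ 0. -/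
open MeasureTheory Real Filter
open scoped Topology

/-- The velocity potential `v(x;Q) = ∫ k(x,x') d(Q' − Q)(x')`. -/
noncomputable def vField {E : Type*} [MeasurableSpace E] (k : E → E → ℝ)
    (Q' Q : Measure E) (x : E) : ℝ :=
  (∫ y, k x y ∂Q') - ∫ y, k x y ∂Q

/-- The centered velocity `v̄(x;Q) = v(x;Q) − ∫ v(·;Q) dQ`. -/
noncomputable def vBar {E : Type*} [MeasurableSpace E] (k : E → E → ℝ)
    (Q' Q : Measure E) (x : E) : ℝ :=
  vField k Q' Q x - ∫ y, vField k Q' Q y ∂Q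

lemma global_ode {E : Type*} [NormedAddCommGroup E] [NormedSpace ℝ E] [CompleteSpace E]
    (F : E → E) (C L : NNReal) (hC : ∀ u, ‖F u‖ ≤ C) (hL : LipschitzWith L F) (u0 : E) :
    ∃ u : ℝ → E, u 0 = u0 ∧ ∀ t, 0 ≤ t → HasDerivWithinAt u (F (u t)) (Set.Ici 0) t := by
  have h1 : ∀ n : ℕ, ∃ α : ℝ → E, α 0 = u0 ∧ ∀ t ∈ Set.Icc (0:ℝ) n,
      HasDerivWithinAt α (F (α t)) (Set.Icc (0:ℝ) n) t := by
    intro n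
    have hp : IsPicardLindelof (fun _ : ℝ => F) (tmin := 0) (tmax := n)
        ⟨0, by simp⟩ u0 (C * n) 0 C L := by
      refine ⟨fun _ _ => hL.lipschitzOnWith, fun _ _ => continuousOn_const,
        fun _ _ u _ => hC u, ?_⟩
      simp
    exact hp.exists_eq_forall_mem_Icc_hasDerivWithinAt₀
  choose α h0 hα using h1
  have huniq : ∀ m n : ℕ, m ≤ n → Set.EqOn (α m) (α n) (Set.Icc 0 m) := by
    intro m n hmn
    have hsub : Set.Icc (0:ℝ) m ⊆ Set.Icc (0:ℝ) n :=
      Set.Icc_subset_Icc_right (by exact_mod_cast hmn)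
    have key : ∀ N : ℕ, m ≤ N → ∀ t ∈ Set.Ico (0:ℝ) m,
        HasDerivWithinAt (α N) (F (α N t)) (Set.Ici t) t := by
      intro N hN t ht
      have hmN : (m:ℝ) ≤ N := by exact_mod_cast hN
      refine (hα N t ⟨ht.1, ht.2.le.trans hmN⟩).mono_of_mem_nhdsWithin ?_
      refine mem_of_superset (Icc_mem_nhdsGE (ht.2.trans_le hmN)) ?_
      exact Set.Icc_subset_Icc_left ht.1
    refine ODE_solution_unique (v := fun _ => F) (fun _ => hL)
      (fun t ht => (hα m t ht).continuousWithinAt) (key m le_rfl)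
      (fun t ht => ((hα n t (hsub ht)).continuousWithinAt).mono hsub) (key n hmn) ?_
    rw [h0, h0]
  have hu : ∀ n : ℕ, ∀ t ∈ Set.Icc (0:ℝ) n, α ⌈t⌉₊ t = α n t := fun n t ht =>
    huniq _ _ (Nat.ceil_le.2 ht.2) ⟨ht.1, Nat.le_ceil t⟩
  refine ⟨fun t => α ⌈t⌉₊ t, by simp [h0], fun t ht => ?_⟩
  obtain ⟨n, hn⟩ := exists_nat_gt t
  have hd := hα n t ⟨ht, hn.le⟩
  have hd2 : HasDerivWithinAt (fun t => α ⌈t⌉₊ t) (F (α n t)) (Set.Icc 0 n) t :=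
    hd.congr (fun s hs => hu n s hs) (hu n t ⟨ht, hn.le⟩)
  rw [← hu n t ⟨ht, hn.le⟩] at hd2
  refine hd2.mono_of_mem_nhdsWithin ?_
  rw [← Set.Ici_inter_Iic]
  exact inter_mem_nhdsWithin _ (Iic_mem_nhds hn)

section compactCase

variable {X : Type*} [MetricSpace X] [CompactSpace X] [MeasurableSpace X] [BorelSpace X]

lemma cm_integrable (P : Measure X) [IsProbabilityMeasure P] (f : C(X, ℝ)) :
    Integrable (fun x => f x) P :=
  Integrable.of_bound f.continuous.aestronglyMeasurable ‖f‖
    (Eventually.of_forall fun x => f.norm_coe_le_norm x)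

lemma cm_abs_integral_le (P : Measure X) [IsProbabilityMeasure P] (f : X → ℝ) (c : ℝ)
    (h : ∀ x, |f x| ≤ c) : |∫ x, f x ∂P| ≤ c := by
  have := norm_integral_le_of_norm_le_const (μ := P) (f := f) (C := c)
    (Eventually.of_forall h)
  simpa using this

lemma vField_cont (κ : C(X × X, ℝ)) (P' P : Measure X) [IsProbabilityMeasure P']
    [IsProbabilityMeasure P] : Continuous (vField (fun x y => κ (x, y)) P' P) := by
  have key : ∀ (P : Measure X) [IsProbabilityMeasure P],
      Continuous fun x => ∫ y, κ (x, y) ∂P := by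
    intro P _
    refine continuous_of_dominated (bound := fun _ => ‖κ‖) ?_ ?_ (integrable_const _) ?_
    · intro x
      exact (by fun_prop : Continuous fun y => κ (x, y)).aestronglyMeasurable
    · exact fun x => Eventually.of_forall fun y => κ.norm_coe_le_norm _
    · exact Eventually.of_forall fun y => by fun_prop
  exact (key P').sub (key P)

/-- The velocity as a continuous map. -/
noncomputable def vMap (κ : C(X × X, ℝ)) (P' P : Measure X) [IsProbabilityMeasure P']
    [IsProbabilityMeasure P] : C(X, ℝ) :=
  ⟨vField (fun x y => κ (x, y)) P' P, vField_cont κ P' P⟩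

lemma vMap_apply (κ : C(X × X, ℝ)) (P' P : Measure X) [IsProbabilityMeasure P']
    [IsProbabilityMeasure P] (x : X) :
    vMap κ P' P x = (∫ y, κ (x, y) ∂P') - ∫ y, κ (x, y) ∂P := rfl

lemma vMap_norm_le (κ : C(X × X, ℝ)) (P' P : Measure X) [IsProbabilityMeasure P']
    [IsProbabilityMeasure P] : ‖vMap κ P' P‖ ≤ 2 * ‖κ‖ := by
  refine (ContinuousMap.norm_le _ (by positivity)).2 fun x => ?_
  rw [vMap_apply, Real.norm_eq_abs]
  have h1 := cm_abs_integral_le P' (fun y => κ (x, y)) ‖κ‖ (fun y => κ.norm_coe_le_norm _)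
  have h2 := cm_abs_integral_le P (fun y => κ (x, y)) ‖κ‖ (fun y => κ.norm_coe_le_norm _)
  have := abs_sub (∫ y, κ (x, y) ∂P') (∫ y, κ (x, y) ∂P)
  linarith

lemma integral_vBar (κ : C(X × X, ℝ)) (P' P : Measure X) [IsProbabilityMeasure P']
    [IsProbabilityMeasure P] (f : C(X, ℝ)) :
    ∫ x, f x * vBar (fun x y => κ (x, y)) P' P x ∂P =
      (∫ x, (f * vMap κ P' P) x ∂P) - (∫ x, f x ∂P) * ∫ x, vMap κ P' P x ∂P := by
  rw [← integral_mul_const, ← integral_sub (cm_integrable P _)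
    ((cm_integrable P f).mul_const _)]
  refine integral_congr_ae (Eventually.of_forall fun x => ?_)
  simp only [vBar, ContinuousMap.mul_apply]
  change f x * (vMap κ P' P x - ∫ y, vMap κ P' P y ∂P) = _
  ring

/-- `P` and `R` are at dual distance at most `ε`. -/
def DualLe (P R : Measure X) (ε : ℝ) : Prop :=
  ∀ f : C(X, ℝ), |(∫ x, f x ∂P) - ∫ x, f x ∂ R| ≤ ε * ‖f‖

lemma vMap_dist (κ : C(X × X, ℝ)) (P' P R : Measure X) [IsProbabilityMeasure P']
    [IsProbabilityMeasure P] [IsProbabilityMeasure R] (ε : ℝ) (hε : 0 ≤ ε)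
    (h : DualLe P R ε) : ‖vMap κ P' P - vMap κ P' R‖ ≤ ‖κ‖ * ε := by
  refine (ContinuousMap.norm_le _ (by positivity)).2 fun x => ?_
  have h1 := h ((κ.comp ⟨fun y => (x, y), by fun_prop⟩ : C(X, ℝ)))
  have h2 : ‖(κ.comp ⟨fun y => (x, y), by fun_prop⟩ : C(X, ℝ))‖ ≤ ‖κ‖ :=
    (ContinuousMap.norm_le _ (norm_nonneg κ)).2 fun y => κ.norm_coe_le_norm _
  have h3 : (vMap κ P' P - vMap κ P' R) x = -((∫ y, κ (x, y) ∂P) - ∫ y, κ (x, y) ∂ R) := by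
    simp only [ContinuousMap.sub_apply, vMap_apply]; ring
  rw [h3, norm_neg, Real.norm_eq_abs]
  refine h1.trans ?_
  rw [mul_comm]
  gcongr

lemma rhs_lipschitz (κ : C(X × X, ℝ)) (P' P R : Measure X) [IsProbabilityMeasure P']
    [IsProbabilityMeasure P] [IsProbabilityMeasure R] (ε : ℝ) (hε : 0 ≤ ε)
    (h : DualLe P R ε) (f : C(X, ℝ)) :
    |(∫ x, f x * vBar (fun x y => κ (x, y)) P' P x ∂P) -
      ∫ x, f x * vBar (fun x y => κ (x, y)) P' R x ∂ R| ≤ 8 * ‖κ‖ * ε * ‖f‖ := by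
  rw [integral_vBar, integral_vBar]
  set M := ‖κ‖ with hM
  have hM0 : 0 ≤ M := norm_nonneg _
  set vP := vMap κ P' P
  set vR := vMap κ P' R
  have hvP : ‖vP‖ ≤ 2 * M := vMap_norm_le κ P' P
  have hvR : ‖vR‖ ≤ 2 * M := vMap_norm_le κ P' R
  have hd : ‖vP - vR‖ ≤ M * ε := vMap_dist κ P' P R ε hε h
  have key : ∀ g : C(X, ℝ), |(∫ x, (g * vP) x ∂P) - ∫ x, (g * vR) x ∂ R| ≤
      3 * M * ε * ‖g‖ := by
    intro g
    have e1 : |(∫ x, (g * vP) x ∂P) - ∫ x, (g * vP) x ∂ R| ≤ ε * (‖g‖ * (2 * M)) :=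
      (h (g * vP)).trans (by
        gcongr
        exact (norm_mul_le _ _).trans (by gcongr))
    have e2 : |∫ x, (g * (vP - vR)) x ∂ R| ≤ ‖g‖ * (M * ε) := by
      refine cm_abs_integral_le R _ _ fun x => ?_
      exact ((g * (vP - vR)).norm_coe_le_norm x).trans
        ((norm_mul_le _ _).trans (by gcongr))
    have e3 : ∫ x, (g * (vP - vR)) x ∂ R = (∫ x, (g * vP) x ∂ R) - ∫ x, (g * vR) x ∂ R := by
      rw [← integral_sub (cm_integrable R _) (cm_integrable R _), mul_sub]
      rfl
    rw [e3] at e2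
    have e4 := abs_sub_le (∫ x, (g * vP) x ∂P) (∫ x, (g * vP) x ∂ R) (∫ x, (g * vR) x ∂ R)
    linarith
  have k1 := key f
  have k2 : |(∫ x, vP x ∂P) - ∫ x, vR x ∂ R| ≤ 3 * M * ε := by
    have := key 1
    simp only [one_mul] at this
    refine this.trans ?_
    have : ‖(1 : C(X, ℝ))‖ ≤ 1 := (ContinuousMap.norm_le _ zero_le_one).2 fun x => by simp
    have h0 : 0 ≤ 3 * M * ε := by positivity
    nlinarith
  have k3 : |∫ x, vP x ∂P| ≤ 2 * M :=
    cm_abs_integral_le P _ _ fun x => (vP.norm_coe_le_norm x).trans hvP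
  have k4 : |∫ x, f x ∂ R| ≤ ‖f‖ := cm_abs_integral_le R _ _ fun x => f.norm_coe_le_norm x
  have k5 := h f
  set a := ∫ x, f x ∂P
  set a' := ∫ x, f x ∂ R
  set b := ∫ x, vP x ∂P
  set b' := ∫ x, vR x ∂ R
  have k6 : |a * b - a' * b'| ≤ (ε * ‖f‖) * (2 * M) + ‖f‖ * (3 * M * ε) := by
    have : a * b - a' * b' = (a - a') * b + a' * (b - b') := by ring
    rw [this]
    refine (abs_add_le _ _).trans ?_
    rw [abs_mul, abs_mul]
    gcongr
  have k7 := abs_sub ((∫ x, (f * vP) x ∂P) - ∫ x, (f * vR) x ∂ R) (a * b - a' * b')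
  have k8 : (∫ x, (f * vP) x ∂P) - a * b - ((∫ x, (f * vR) x ∂ R) - a' * b') =
    ((∫ x, (f * vP) x ∂P) - ∫ x, (f * vR) x ∂ R) - (a * b - a' * b') := by ring
  rw [k8]
  linarith

lemma uniq_compact (κ : C(X × X, ℝ)) (P' : Measure X) [IsProbabilityMeasure P']
    (P R : ℝ → Measure X) (h0 : P 0 = R 0)
    (hP : ∀ t, 0 ≤ t → IsProbabilityMeasure (P t))
    (hR : ∀ t, 0 ≤ t → IsProbabilityMeasure (R t))
    (dP : ∀ f : C(X, ℝ), ∀ t : ℝ, 0 ≤ t → HasDerivWithinAt (fun s => ∫ x, f x ∂(P s))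
      (∫ x, f x * vBar (fun x y => κ (x, y)) P' (P t) x ∂(P t)) (Set.Ici 0) t)
    (dR : ∀ f : C(X, ℝ), ∀ t : ℝ, 0 ≤ t → HasDerivWithinAt (fun s => ∫ x, f x ∂(R s))
      (∫ x, f x * vBar (fun x y => κ (x, y)) P' (R t) x ∂(R t)) (Set.Ici 0) t)
    (t : ℝ) (ht : 0 ≤ t) : P t = R t := by
  have main : ∀ n : ℕ, ∀ t, 0 ≤ t →
      DualLe (P t) (R t) (2 * ((8 * ‖κ‖ * t) ^ n / n.factorial)) := by
    intro n
    induction n with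
    | zero =>
      intro t ht f
      have := hP t ht
      have := hR t ht
      have h1 : |∫ x, f x ∂(P t)| ≤ ‖f‖ :=
        cm_abs_integral_le _ _ _ fun x => f.norm_coe_le_norm x
      have h2 : |∫ x, f x ∂(R t)| ≤ ‖f‖ :=
        cm_abs_integral_le _ _ _ fun x => f.norm_coe_le_norm x
      have := abs_sub (∫ x, f x ∂(P t)) (∫ x, f x ∂(R t))
      simp
      linarith
    | succ n ih =>
      intro T hT f
      have hd : ∀ s, 0 ≤ s → HasDerivWithinAt
          (fun s => (∫ x, f x ∂(P s)) - ∫ x, f x ∂(R s)) _ (Set.Ici 0) s :=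
        fun s hs => (dP f s hs).sub (dR f s hs)
      have := image_norm_le_of_norm_deriv_right_le_deriv_boundary (a := 0) (b := T)
        (f := fun s => (∫ x, f x ∂(P s)) - ∫ x, f x ∂(R s))
        (B := fun s => 2 * ((8 * ‖κ‖ * s) ^ (n + 1) / (n + 1).factorial) * ‖f‖)
        (B' := fun s => 8 * ‖κ‖ * (2 * ((8 * ‖κ‖ * s) ^ n / n.factorial)) * ‖f‖)
        (fun s hs => ((hd s hs.1).continuousWithinAt).mono Set.Icc_subset_Ici_self)
        (fun s hs => (hd s hs.1).mono (Set.Ici_subset_Ici.2 hs.1))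
        (by simp [h0]) ?_ ?_ (Set.right_mem_Icc.2 hT)
      · exact this
      · intro s
        have h1 : HasDerivAt (fun s : ℝ => 8 * ‖κ‖ * s) (8 * ‖κ‖) s := by
          simpa using (hasDerivAt_id s).const_mul (8 * ‖κ‖)
        have h2 := (((h1.pow (n + 1)).div_const ((n + 1).factorial : ℝ)).const_mul
          (2 : ℝ)).mul_const ‖f‖
        convert! h2 using 1
        rw [Nat.factorial_succ]
        have : (n.factorial : ℝ) ≠ 0 := by positivity
        push_cast
        field_simp
      · intro s hs
        have := hP s hs.1
        have := hR s hs.1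
        have hs0 : 0 ≤ s := hs.1
        exact rhs_lipschitz κ P' (P s) (R s) _ (by positivity) (ih s hs.1) f
  have := hP t ht
  have := hR t ht
  refine ext_of_forall_integral_eq_of_IsFiniteMeasure fun f => ?_
  have hlim : Tendsto (fun n : ℕ =>
      2 * ((8 * ‖κ‖ * t) ^ n / n.factorial) * ‖f.toContinuousMap‖) atTop (𝓝 0) := by
    have := ((FloorSemiring.tendsto_pow_div_factorial_atTop (8 * ‖κ‖ * t)).const_mul 2).mul_const
      ‖f.toContinuousMap‖
    simpa using this
  have := ge_of_tendsto' hlim (fun n => main n t ht f.toContinuousMap)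
  exact sub_eq_zero.1 (abs_eq_zero.1 (le_antisymm this (abs_nonneg _)))


lemma exp_diff_le (p q : ℝ) : |exp p - exp q| ≤ |p - q| * (exp p + exp q) := by
  wlog h : q ≤ p generalizing p q
  · have := this q p (le_of_not_ge h)
    rw [abs_sub_comm, abs_sub_comm p q, add_comm]
    exact this
  rw [abs_of_nonneg (sub_nonneg.2 (exp_le_exp.2 h)), abs_of_nonneg (sub_nonneg.2 h)]
  have h1 := add_one_le_exp (q - p)
  have h2 : exp q = exp p * exp (q - p) := by rw [← exp_add]; congr 1; ring
  have h3 := exp_pos p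
  have h4 := mul_le_mul_of_nonneg_left h1 h3.le
  have h5 : 0 ≤ (p - q) * exp q := mul_nonneg (sub_nonneg.2 h) (exp_pos q).le
  nlinarith

/-- The exponential of a continuous map. -/
noncomputable def expMap (u : C(X, ℝ)) : C(X, ℝ) := ⟨fun x => exp (u x), by fun_prop⟩

lemma expMap_apply (u : C(X, ℝ)) (x : X) : expMap u x = exp (u x) := rfl

lemma tilted_prob (P : Measure X) [IsProbabilityMeasure P] (u : C(X, ℝ)) :
    IsProbabilityMeasure (P.tilted u) :=
  isProbabilityMeasure_tilted (cm_integrable P (expMap u))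

lemma Z_pos (P : Measure X) [IsProbabilityMeasure P] (u : C(X, ℝ)) :
    0 < ∫ x, expMap u x ∂P :=
  integral_exp_pos (cm_integrable P (expMap u))

lemma tilted_integral (P : Measure X) [IsProbabilityMeasure P] (u g : C(X, ℝ)) :
    ∫ x, g x ∂(P.tilted u) = (∫ x, (expMap u * g) x ∂P) / ∫ x, expMap u x ∂P := by
  rw [integral_tilted, ← integral_div]
  refine integral_congr_ae (Eventually.of_forall fun x => ?_)
  simp only [smul_eq_mul, ContinuousMap.mul_apply, expMap_apply]
  ring

lemma num_diff (P : Measure X) [IsProbabilityMeasure P] (u w g : C(X, ℝ)) :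
    |(∫ x, (expMap u * g) x ∂P) - ∫ x, (expMap w * g) x ∂P| ≤
      ‖u - w‖ * ‖g‖ * ((∫ x, expMap u x ∂P) + ∫ x, expMap w x ∂P) := by
  rw [← integral_sub (cm_integrable P _) (cm_integrable P _),
    ← integral_add (cm_integrable P _) (cm_integrable P _), ← integral_const_mul]
  rw [← Real.norm_eq_abs]
  refine norm_integral_le_of_norm_le
    (((cm_integrable P (expMap u)).add (cm_integrable P (expMap w))).const_mul _) (Eventually.of_forall fun x => ?_)
  simp only [ContinuousMap.mul_apply, expMap_apply]
  rw [← sub_mul, norm_mul]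
  have h1 := exp_diff_le (u x) (w x)
  have h2 : |u x - w x| ≤ ‖u - w‖ := (u - w).norm_coe_le_norm x
  have h3 := g.norm_coe_le_norm x
  have h4 : 0 < exp (u x) + exp (w x) := by positivity
  calc ‖exp (u x) - exp (w x)‖ * ‖g x‖ ≤ (‖u - w‖ * (exp (u x) + exp (w x))) * ‖g‖ := by
        gcongr
        exact h1.trans (by gcongr)
    _ = _ := by ring

lemma tilted_dual (P : Measure X) [IsProbabilityMeasure P] (u w : C(X, ℝ)) :
    DualLe (P.tilted u) (P.tilted w) (4 * ‖u - w‖) := by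
  intro g
  wlog h : (∫ x, expMap w x ∂P) ≤ ∫ x, expMap u x ∂P generalizing u w
  · have := this w u (le_of_not_ge h)
    rw [abs_sub_comm, norm_sub_rev]
    exact this
  have := tilted_prob P w
  have hB : |∫ x, g x ∂(P.tilted w)| ≤ ‖g‖ :=
    cm_abs_integral_le _ _ _ fun x => g.norm_coe_le_norm x
  have n1 := num_diff P u w g
  have n2 := num_diff P u w 1
  have hn1 : ‖(1 : C(X, ℝ))‖ ≤ 1 := (ContinuousMap.norm_le _ zero_le_one).2 fun x => by simp
  simp only [mul_one] at n2
  rw [tilted_integral P w] at hB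
  rw [tilted_integral, tilted_integral]
  have ha := Z_pos P u
  have hb := Z_pos P w
  set a := ∫ x, expMap u x ∂P
  set b := ∫ x, expMap w x ∂P
  set A := ∫ x, (expMap u * g) x ∂P
  set B := ∫ x, (expMap w * g) x ∂P
  set δ := ‖u - w‖
  have hδ : 0 ≤ δ := norm_nonneg _
  have hg : 0 ≤ ‖g‖ := norm_nonneg _
  have n2' : |b - a| ≤ δ * (a + b) := by
    rw [abs_sub_comm]
    refine n2.trans ?_
    have : δ * ‖(1 : C(X, ℝ))‖ ≤ δ := by nlinarith
    gcongr
  have e : A / a - B / b = ((A - B) + (B / b) * (b - a)) / a := by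
    field_simp
    ring
  rw [e, abs_div, abs_of_pos ha, div_le_iff₀ ha]
  refine (abs_add_le _ _).trans ?_
  rw [abs_mul]
  calc |A - B| + |B / b| * |b - a| ≤ δ * ‖g‖ * (a + b) + ‖g‖ * (δ * (a + b)) := by gcongr
    _ ≤ δ * ‖g‖ * (a + a) + ‖g‖ * (δ * (a + a)) := by gcongr
    _ = _ := by ring

lemma expMap_eq (u : C(X, ℝ)) : expMap u = NormedSpace.exp u := by
  ext x
  have := NormedSpace.map_exp_of_mem_ball (𝕂 := ℝ) (ContinuousMap.evalAlgHom ℝ ℝ x)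
    (by exact continuous_eval_const x) u
    ((NormedSpace.expSeries_radius_eq_top ℝ C(X, ℝ)).symm ▸ edist_lt_top _ _)
  rw [← Real.exp_eq_exp_ℝ] at this
  exact this.symm

/-- Integration as a continuous linear functional. -/
noncomputable def intL (P : Measure X) [IsProbabilityMeasure P] : C(X, ℝ) →L[ℝ] ℝ :=
  LinearMap.mkContinuous
    { toFun := fun f => ∫ x, f x ∂P
      map_add' := fun f g => integral_add (cm_integrable P f) (cm_integrable P g)
      map_smul' := fun c f => integral_const_mul c _ } 1
    (fun f => by
      rw [one_mul]
      exact cm_abs_integral_le P _ _ fun x => f.norm_coe_le_norm x)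

lemma intL_apply (P : Measure X) [IsProbabilityMeasure P] (f : C(X, ℝ)) :
    intL P f = ∫ x, f x ∂P := rfl

lemma num_deriv (P : Measure X) [IsProbabilityMeasure P] (u : ℝ → C(X, ℝ)) (u' f : C(X, ℝ))
    (t : ℝ) (s : Set ℝ) (h : HasDerivWithinAt u u' s t) :
    HasDerivWithinAt (fun r => ∫ x, (expMap (u r) * f) x ∂P)
      (∫ x, (expMap (u t) * (f * u')) x ∂P) s t := by
  have h1 := (hasFDerivAt_exp (𝕂 := ℝ) (x := u t)).comp_hasDerivWithinAt t h
  have h2 : HasDerivWithinAt (fun r => expMap (u r)) (expMap (u t) * u') s t := by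
    simp only [expMap_eq]
    exact h1
  have h3 := (intL P).hasFDerivAt.comp_hasDerivWithinAt t (h2.mul_const f)
  have e : expMap (u t) * (f * u') = expMap (u t) * u' * f := by ring
  rw [e]
  exact h3

lemma exist_compact (κ : C(X × X, ℝ)) (P' P0 : Measure X) [IsProbabilityMeasure P']
    [IsProbabilityMeasure P0] :
    ∃ P : ℝ → Measure X, P 0 = P0 ∧ (∀ t, IsProbabilityMeasure (P t)) ∧
    (∀ f : C(X, ℝ), ∀ t : ℝ, 0 ≤ t → HasDerivWithinAt (fun s => ∫ x, f x ∂(P s))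
      (∫ x, f x * vBar (fun x y => κ (x, y)) P' (P t) x ∂(P t)) (Set.Ici 0) t) := by
  have inst : ∀ u : C(X, ℝ), IsProbabilityMeasure (P0.tilted u) := tilted_prob P0
  obtain ⟨u, hu0, hu⟩ := global_ode (fun u : C(X, ℝ) => vMap κ P' (P0.tilted u))
    (2 * ‖κ‖₊) (‖κ‖₊ * 4)
    (fun u => by simpa using vMap_norm_le κ P' (P0.tilted u))
    (LipschitzWith.of_dist_le_mul fun u w => by
      rw [dist_eq_norm, dist_eq_norm]
      have := vMap_dist κ P' (P0.tilted u) (P0.tilted w) _ (by positivity) (tilted_dual P0 u w)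
      push_cast
      rw [mul_assoc]
      exact this) 0
  refine ⟨fun t => P0.tilted (u t), ?_, fun t => inst _, fun f t ht => ?_⟩
  · simp only [hu0]
    simp
  rw [integral_vBar]
  set v := vMap κ P' (P0.tilted (u t)) with hv
  have hd := hu t ht
  have d1 := num_deriv P0 u v f t _ hd
  have d2 := num_deriv P0 u v 1 t _ hd
  simp only [mul_one, one_mul] at d2
  have hZ := Z_pos P0 (u t)
  have d3 := d1.div d2 hZ.ne'
  have e : (fun s => ∫ x, f x ∂(P0.tilted (u s))) =
      fun s => (∫ x, (expMap (u s) * f) x ∂P0) / ∫ x, expMap (u s) x ∂P0 := by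
    funext s
    exact tilted_integral P0 (u s) f
  rw [e, tilted_integral P0 (u t) (f * v), tilted_integral P0 (u t) f,
    tilted_integral P0 (u t) v]
  convert! d3 using 1
  field_simp

end compactCase

lemma map_comap_K {d : ℕ} (K : Set (Fin d → ℝ)) (hK : IsCompact K) (Q : Measure (Fin d → ℝ))
    (hQ : Q Kᶜ = 0) :
    Measure.map (Subtype.val : K → Fin d → ℝ) (Measure.comap Subtype.val Q) = Q := by
  rw [map_comap_subtype_coe hK.measurableSet]
  exact Measure.restrict_eq_self_of_ae_mem (mem_ae_iff.2 hQ)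

lemma comap_prob {d : ℕ} (K : Set (Fin d → ℝ)) (hK : IsCompact K) (Q : Measure (Fin d → ℝ))
    [IsProbabilityMeasure Q] (hQ : Q Kᶜ = 0) :
    IsProbabilityMeasure (Measure.comap (Subtype.val : K → Fin d → ℝ) Q) := by
  constructor
  rw [← Set.preimage_univ (f := (Subtype.val : K → Fin d → ℝ)),
    ← Measure.map_apply measurable_subtype_coe MeasurableSet.univ, map_comap_K K hK Q hQ]
  exact measure_univ

lemma vBar_map {d : ℕ} (K : Set (Fin d → ℝ)) (hK : IsCompact K)
    (k : (Fin d → ℝ) → (Fin d → ℝ) → ℝ) (P' P : Measure K) (x : K) :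
    vBar k (P'.map Subtype.val) (P.map Subtype.val) x = vBar (fun x y : K => k x y) P' P x := by
  have he := MeasurableEmbedding.subtype_coe hK.measurableSet
  simp only [vBar, vField, he.integral_map]

lemma rhs_map {d : ℕ} (K : Set (Fin d → ℝ)) (hK : IsCompact K)
    (k : (Fin d → ℝ) → (Fin d → ℝ) → ℝ) (P' P : Measure K) (f : (Fin d → ℝ) → ℝ) :
    ∫ x, f x * vBar k (P'.map Subtype.val) (P.map Subtype.val) x ∂(P.map Subtype.val) =
      ∫ x : K, f x * vBar (fun x y : K => k x y) P' P x ∂P := by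
  have he := MeasurableEmbedding.subtype_coe hK.measurableSet
  rw [he.integral_map]
  simp only [vBar_map K hK]

theorem measure_dynamics_wellposed {d : ℕ}
    (K : Set (Fin d → ℝ)) (hK : IsCompact K)
    (k : (Fin d → ℝ) → (Fin d → ℝ) → ℝ)
    (hkcont : ContinuousOn (fun p : (Fin d → ℝ) × (Fin d → ℝ) => k p.1 p.2) (K ×ˢ K))
    (Q' : Measure (Fin d → ℝ)) [IsProbabilityMeasure Q'] (hQ' : Q' Kᶜ = 0)
    (Q0 : Measure (Fin d → ℝ)) [IsProbabilityMeasure Q0] (hQ0 : Q0 Kᶜ = 0) :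
    ∃ Q : ℝ → Measure (Fin d → ℝ),
      Q 0 = Q0 ∧
      (∀ t : ℝ, 0 ≤ t → IsProbabilityMeasure (Q t) ∧ Q t Kᶜ = 0) ∧
      (∀ f : ContinuousMap (Fin d → ℝ) ℝ, ∀ t : ℝ, 0 ≤ t →
        HasDerivWithinAt (fun s => ∫ x, f x ∂(Q s))
          (∫ x, f x * vBar k Q' (Q t) x ∂(Q t)) (Set.Ici 0) t) ∧
      (∀ Qt : ℝ → Measure (Fin d → ℝ), Qt 0 = Q0 →
        (∀ t : ℝ, 0 ≤ t → IsProbabilityMeasure (Qt t) ∧ Qt t Kᶜ = 0) →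
        (∀ f : ContinuousMap (Fin d → ℝ) ℝ, ∀ t : ℝ, 0 ≤ t →
          HasDerivWithinAt (fun s => ∫ x, f x ∂(Qt s))
            (∫ x, f x * vBar k Q' (Qt t) x ∂(Qt t)) (Set.Ici 0) t) →
        ∀ t : ℝ, 0 ≤ t → Qt t = Q t) := by

  have he := MeasurableEmbedding.subtype_coe hK.measurableSet
  have : CompactSpace K := isCompact_iff_compactSpace.1 hK
  let κ : C(K × K, ℝ) := ⟨fun p => k p.1 p.2, by
    have h : Continuous fun p : K × K =>
        (⟨((p.1 : Fin d → ℝ), (p.2 : Fin d → ℝ)), ⟨p.1.2, p.2.2⟩⟩ : (K ×ˢ K : Set _)) := by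
      fun_prop
    exact (continuousOn_iff_continuous_domRestrict.1 hkcont).comp h⟩
  have hP' := comap_prob K hK Q' hQ'
  have hP0 := comap_prob K hK Q0 hQ0
  obtain ⟨P, h0, hP, hd⟩ := exist_compact κ (Measure.comap Subtype.val Q')
    (Measure.comap Subtype.val Q0)
  have hQ'e := map_comap_K K hK Q' hQ'
  refine ⟨fun t => (P t).map Subtype.val, ?_, ?_, ?_, ?_⟩
  · simp only [h0]
    exact map_comap_K K hK Q0 hQ0
  · intro t _
    have := hP t
    refine ⟨Measure.isProbabilityMeasure_map measurable_subtype_coe.aemeasurable, ?_⟩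
    rw [Measure.map_apply measurable_subtype_coe hK.measurableSet.compl]
    simp
  · intro f t ht
    have h1 := hd (f.restrict K) t ht
    have h2 := rhs_map K hK k (Measure.comap Subtype.val Q') (P t) f
    rw [hQ'e] at h2
    rw [h2]
    simp only [he.integral_map]
    exact h1
  · intro Qt hQt0 hQt hQtd t ht
    have hmap : ∀ s, 0 ≤ s → ((Qt s).comap (Subtype.val : K → _)).map Subtype.val = Qt s :=
      fun s hs => map_comap_K K hK _ (hQt s hs).2
    rw [← hmap t ht]
    congr 1
    refine uniq_compact κ (Measure.comap Subtype.val Q')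
      (fun s => (Qt s).comap (Subtype.val : K → _)) P ?_ ?_ (fun s _ => hP s) ?_ hd t ht
    · simp only [hQt0, h0]
    · intro s hs
      have := (hQt s hs).1
      exact comap_prob K hK _ (hQt s hs).2
    · intro f s hs
      obtain ⟨g, hg⟩ := ContinuousMap.exists_restrict_eq hK.isClosed f
      have hgf : ∀ x : K, f x = g x := fun x => by rw [← hg]; rfl
      have h1 := hQtd g s hs
      have h2 := rhs_map K hK k (Measure.comap Subtype.val Q')
        ((Qt s).comap (Subtype.val : K → _)) g
      rw [hQ'e, hmap s hs] at h2
      rw [h2] at h1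
      have h3 : ∀ r ∈ Set.Ici (0:ℝ), (∫ x, f x ∂((Qt r).comap (Subtype.val : K → _))) =
          ∫ x, g x ∂(Qt r) := by
        intro r hr
        conv_rhs => rw [← hmap r hr]
        rw [he.integral_map]
        simp only [hgf]
      have h4 := h1.congr h3 (h3 s hs)
      simp only [← hgf] at h4
      exact h4
end
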